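/- For every real x > 0 and every real v, the translate of G satisfies G(v + log x) = √x · e^{v/2} · α(x e^{v}) · β(e^{−v}/x). -/

import Mathlib

open scoped Real
open Real

noncomputable section

/-- `a(2^l * m) = 2^l * σ₁(m)` for `m` odd; in particular `a(n) = σ₁(n)` for odd `n`. -/
def paperA (n : ℕ) : ℤ :=
  2 ^ (n.factorization 2) * (ArithmeticFunction.sigma 1 (ordCompl[2] n) : ℤ)

/-- `b(n) = σ₁(n)` for odd `n`, `b(n) = 0` for even `n`. -/
def paperB (n : ℕ) : ℤ :=
  if Odd n then (ArithmeticFunction.sigma 1 n : ℤ) else 0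

/-- `α(u) = Σ_{k≥1} a(k) e^{−π k u}`. -/
def alphaFn (u : ℝ) : ℝ := ∑' k : ℕ, (paperA k : ℝ) * Real.exp (-(π * k * u))

/-- `β(u) = Σ_{l≥1} b(l) e^{−π l u}`. -/
def betaFn (u : ℝ) : ℝ := ∑' l : ℕ, (paperB l : ℝ) * Real.exp (-(π * l * u))

/-- `g(v, x) = e^{v/2} exp(−(x/2)(e^v + e^{−v}))`. -/
def paperg (v x : ℝ) : ℝ :=
  Real.exp (v / 2) * Real.exp (-(x / 2) * (Real.exp v + Real.exp (-v)))

/-- `G(v) = Σ_{j≥1} Σ_{d∣j} a(d) b(j/d) (j/d²)^{1/4} g(v − (1/2)log(j/d²), 2π√j)`. -/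
def paperG (v : ℝ) : ℝ :=
  ∑' j : ℕ, ∑ d ∈ j.divisors,
    (paperA d : ℝ) * (paperB (j / d) : ℝ) * ((j : ℝ) / (d : ℝ) ^ 2) ^ ((1 : ℝ) / 4) *
      paperg (v - (1 / 2) * Real.log ((j : ℝ) / (d : ℝ) ^ 2)) (2 * π * Real.sqrt j)

theorem tsum_mul_tsum_eq_tsum_sum_divisors {f g : ℕ → ℝ} (hf0 : f 0 = 0) (hg0 : g 0 = 0)
    (hf : Summable fun n ↦ ‖f n‖) (hg : Summable fun n ↦ ‖g n‖) :
    (∑' k, f k) * ∑' l, g l = ∑' j : ℕ, ∑ d ∈ j.divisors, f d * g (j / d) := by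
  have hf' := hf.comp_injective PNat.coe_injective
  have hg' := hg.comp_injective PNat.coe_injective
  have hfg : Summable fun p : ℕ+ × ℕ+ ↦ f p.1 * g p.2 :=
    summable_mul_of_summable_norm (f := fun k : ℕ+ ↦ f k) (g := fun l : ℕ+ ↦ g l) hf' hg'
  rw [← tsum_pnat_eq_tsum_of_eq_zero hf0, ← tsum_pnat_eq_tsum_of_eq_zero hg0,
    ← tsum_pnat_eq_tsum_of_eq_zero
      (f := fun j : ℕ ↦ ∑ d ∈ j.divisors, f d * g (j / d)) (by simp),
    tsum_mul_tsum_of_summable_norm (f := fun k : ℕ+ ↦ f k) (g := fun l : ℕ+ ↦ g l) hf' hg',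
    ← sigmaAntidiagonalEquivProd.tsum_eq]
  refine (sigmaAntidiagonalEquivProd.summable_iff.mpr hfg).tsum_sigma.trans ?_
  refine tsum_congr fun j ↦ ?_
  rw [← Nat.sum_divisorsAntidiagonal (fun i k ↦ f i * g k),
    ← Finset.tsum_subtype (j : ℕ).divisorsAntidiagonal fun p ↦ f p.1 * g p.2]
  rfl

theorem abs_paperA_le (n : ℕ) : |(paperA n : ℝ)| ≤ (n : ℝ) ^ 3 := by
  rcases eq_or_ne n 0 with rfl | hn
  · simp [paperA]
  have h : 2 ^ n.factorization 2 * ArithmeticFunction.sigma 1 (ordCompl[2] n) ≤ n * n ^ 2 :=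
    Nat.mul_le_mul (Nat.ordProj_le 2 hn)
      ((ArithmeticFunction.sigma_le_pow_succ 1 _).trans
        (Nat.pow_le_pow_left (Nat.ordCompl_le n 2) 2))
  rw [← pow_succ'] at h
  rw [paperA, abs_of_nonneg (by positivity)]
  exact_mod_cast h

theorem abs_paperB_le (n : ℕ) : |(paperB n : ℝ)| ≤ (n : ℝ) ^ 2 := by
  rw [paperB]
  split_ifs
  · rw [abs_of_nonneg (by positivity)]
    exact_mod_cast ArithmeticFunction.sigma_le_pow_succ 1 n
  · simp

theorem summable_norm_mul_exp_of_abs_le_pow {c : ℕ → ℝ} {k : ℕ} (hc : ∀ n, |c n| ≤ (n : ℝ) ^ k)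
    {u : ℝ} (hu : 0 < u) : Summable fun n : ℕ ↦ ‖c n * Real.exp (-(π * n * u))‖ := by
  refine (Real.summable_pow_mul_exp_neg_nat_mul k (mul_pos Real.pi_pos hu)).of_nonneg_of_le
    (fun _ ↦ norm_nonneg _) fun n ↦ ?_
  rw [norm_mul, Real.norm_eq_abs, Real.norm_eq_abs, Real.abs_exp,
    show -(π * n * u) = -(π * u) * n by ring]
  gcongr
  exact hc n

theorem alphaFn_mul_betaFn {u w : ℝ} (hu : 0 < u) (hw : 0 < w) :
    alphaFn u * betaFn w = ∑' j : ℕ, ∑ d ∈ j.divisors,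
      ((paperA d : ℝ) * Real.exp (-(π * d * u))) *
        ((paperB (j / d) : ℝ) * Real.exp (-(π * (j / d : ℕ) * w))) :=
  tsum_mul_tsum_eq_tsum_sum_divisors (by simp [paperA]) (by simp [paperB])
    (summable_norm_mul_exp_of_abs_le_pow abs_paperA_le hu)
    (summable_norm_mul_exp_of_abs_le_pow abs_paperB_le hw)

theorem rpow_mul_paperg_sub_log {k l : ℝ} (hk : 0 < k) (hl : 0 < l) (w : ℝ) :
    (k * l / k ^ 2) ^ ((1 : ℝ) / 4) *
        paperg (w - 1 / 2 * Real.log (k * l / k ^ 2)) (2 * π * Real.sqrt (k * l)) =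
      Real.exp (w / 2) *
        (Real.exp (-(π * k * Real.exp w)) * Real.exp (-(π * l * Real.exp (-w)))) := by
  obtain ⟨s, rfl⟩ : ∃ s, Real.exp s = k := ⟨_, Real.exp_log hk⟩
  obtain ⟨t, rfl⟩ : ∃ t, Real.exp t = l := ⟨_, Real.exp_log hl⟩
  have hquot : Real.exp s * Real.exp t / Real.exp s ^ 2 = Real.exp (t - s) := by
    rw [Real.exp_sub]
    field_simp
  have hsqrt : Real.sqrt (Real.exp s * Real.exp t) = Real.exp ((s + t) / 2) := by
    rw [← Real.exp_add, Real.exp_half]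
  rw [hquot, hsqrt, Real.log_exp, paperg, ← Real.exp_mul, ← mul_assoc, ← Real.exp_add,
    ← Real.exp_add (-_)]
  congr 2
  · ring
  · have h₁ : Real.exp ((s + t) / 2) * Real.exp (w - 1 / 2 * (t - s)) =
        Real.exp s * Real.exp w := by
      rw [← Real.exp_add, ← Real.exp_add]
      ring_nf
    have h₂ : Real.exp ((s + t) / 2) * Real.exp (-(w - 1 / 2 * (t - s))) =
        Real.exp t * Real.exp (-w) := by
      rw [← Real.exp_add, ← Real.exp_add]
      ring_nf
    linear_combination (-π) * h₁ - π * h₂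

theorem paperG_eq (w : ℝ) :
    paperG w = Real.exp (w / 2) * (alphaFn (Real.exp w) * betaFn (Real.exp (-w))) := by
  rw [alphaFn_mul_betaFn (Real.exp_pos _) (Real.exp_pos _), ← tsum_mul_left, paperG]
  refine tsum_congr fun j ↦ ?_
  rw [Finset.mul_sum]
  refine Finset.sum_congr rfl fun d hd ↦ ?_
  obtain ⟨⟨l, rfl⟩, hj⟩ := Nat.mem_divisors.mp hd
  obtain ⟨hd0, hl0⟩ := mul_ne_zero_iff.mp hj
  rw [Nat.mul_div_cancel_left l (Nat.pos_of_ne_zero hd0), Nat.cast_mul, mul_assoc,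
    rpow_mul_paperg_sub_log (by positivity) (by positivity)]
  ring

theorem translate_of_G (x : ℝ) (hx : 0 < x) (v : ℝ) :
    paperG (v + Real.log x) =
      Real.sqrt x * Real.exp (v / 2) * alphaFn (x * Real.exp v) *
        betaFn (Real.exp (-v) / x) := by
  rw [paperG_eq, Real.exp_add, Real.exp_log hx, neg_add, Real.exp_add, Real.exp_neg (Real.log x),
    Real.exp_log hx, add_div, Real.exp_add, Real.exp_half (Real.log x), Real.exp_log hx,
    mul_comm (Real.exp v) x, ← div_eq_mul_inv]
  ring
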